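/- arXiv:1406.0647 — 3 statements merged into one kernel-verified Lean document; each statement's English description precedes it below -/
import Mathlib

section
/- Let m₁,…,m₅, M₁, M₂, M ∈ ℝ³ and R₂ > 0 with |‖m₂ − m₁‖ − ‖M₂ − M‖| < R₂ < ‖m₂ − m₁‖ + ‖M₂ − M‖. Consider the pentapod with platform points m₁,…,m₅, base points M₁, M₂ and M₃ = M₄ = M₅ = M, and leg lengths R₁ = ‖M − M₁‖, R₂, and Rᵢ = ‖mᵢ − m₁‖ for i = 3, 4, 5. Then its configuration set contains the image of an injective continuous map from the open unit ball of ℝ²; i.e., the pentapod has a 2-dimensional spherical self-motion, obtained by placing m₁ at M₃ = M₄ = M₅. (Sufficiency part of item 1 of Theorem 4: for a pentapod with M₃ = M₄ = M₅ this condition is already sufficient for mobility 2.) -/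
open Metric

noncomputable section

local notation "E2" => EuclideanSpace ℝ (Fin 2)
local notation "E3" => EuclideanSpace ℝ (Fin 3)

/-- A pose of the rigid body, acting by `x ↦ Q·x + t`. -/
abbrev Pose := Matrix (Fin 3) (Fin 3) ℝ × EuclideanSpace ℝ (Fin 3)

/-- Configuration set of a pentapod with platform points `m`, base points `M`
and leg lengths `R`. -/
def pentapodConfig (m M : Fin 5 → EuclideanSpace ℝ (Fin 3)) (R : Fin 5 → ℝ) :
    Set Pose :=
  {p | p.1 ∈ Matrix.specialOrthogonalGroup (Fin 3) ℝ ∧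
    ∀ i : Fin 5, ‖Matrix.toEuclideanLin p.1 (m i) + p.2 - M i‖ = R i}

/-- The configuration set contains the image of an injective continuous map
from the open unit ball of `ℝ²`: a 2-dimensional self-motion. -/
def HasTwoDimSelfMotion (K : Set Pose) : Prop :=
  ∃ φ : EuclideanSpace ℝ (Fin 2) → Pose,
    ContinuousOn φ (Metric.ball 0 1) ∧ Set.InjOn φ (Metric.ball 0 1) ∧
    ∀ x ∈ Metric.ball (0 : EuclideanSpace ℝ (Fin 2)) 1, φ x ∈ K


def pRz (s c : ℝ) : Matrix (Fin 3) (Fin 3) ℝ := !![c, -s, 0; s, c, 0; 0, 0, 1]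

def pRx (s c : ℝ) : Matrix (Fin 3) (Fin 3) ℝ := !![1, 0, 0; 0, c, -s; 0, s, c]

lemma pRz_mem (s c : ℝ) (h : s ^ 2 + c ^ 2 = 1) :
    pRz s c ∈ Matrix.specialOrthogonalGroup (Fin 3) ℝ := by
  rw [Matrix.mem_specialOrthogonalGroup_iff, Matrix.mem_orthogonalGroup_iff]
  constructor
  · ext i j
    fin_cases i <;> fin_cases j <;>
      simp [pRz, Matrix.mul_apply, Fin.sum_univ_three, Matrix.star_apply] <;>
      first | linear_combination h | ring
  · simp [pRz, Matrix.det_fin_three]; linear_combination h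

lemma pRx_mem (s c : ℝ) (h : s ^ 2 + c ^ 2 = 1) :
    pRx s c ∈ Matrix.specialOrthogonalGroup (Fin 3) ℝ := by
  rw [Matrix.mem_specialOrthogonalGroup_iff, Matrix.mem_orthogonalGroup_iff]
  constructor
  · ext i j
    fin_cases i <;> fin_cases j <;>
      simp [pRx, Matrix.mul_apply, Fin.sum_univ_three, Matrix.star_apply] <;>
      first | linear_combination h | ring
  · simp [pRx, Matrix.det_fin_three]; linear_combination h

lemma align (a : E3) : ∃ A ∈ Matrix.specialOrthogonalGroup (Fin 3) ℝ,
    Matrix.toEuclideanLin A a = !₂[0, 0, ‖a‖] := by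
  have hn : ‖a‖ ^ 2 = a 0 ^ 2 + a 1 ^ 2 + a 2 ^ 2 := by
    rw [EuclideanSpace.real_norm_sq_eq, Fin.sum_univ_three]
  have hn0 := norm_nonneg a
  generalize ‖a‖ = n at *
  generalize hx : a 0 = x at *
  generalize hy : a 1 = y at *
  generalize hz : a 2 = z at *
  by_cases hc : n + z = 0
  · have hz' : z = -n := by linarith
    have hxx : x = 0 := by subst hz'; nlinarith [sq_nonneg x, sq_nonneg y]
    have hyy : y = 0 := by subst hz'; nlinarith [sq_nonneg x, sq_nonneg y]
    refine ⟨pRx 0 (-1), pRx_mem _ _ (by norm_num), ?_⟩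
    ext i
    fin_cases i <;>
      simp [pRx, Matrix.toLpLin_apply, Matrix.mulVec, dotProduct, Fin.sum_univ_three, hx, hy, hz,
        hxx, hyy, hz']
  · have hnn : n ≠ 0 := by
      rintro rfl
      apply hc
      nlinarith [sq_nonneg x, sq_nonneg y, sq_nonneg z]
    obtain ⟨k, hk⟩ : ∃ k : ℝ, k * (n * (n + z)) = 1 :=
      ⟨(n * (n + z))⁻¹, inv_mul_cancel₀ (mul_ne_zero hnn hc)⟩
    have hv : k * (x ^ 2 + y ^ 2 + (z + n) ^ 2) = 2 := by
      linear_combination 2 * hk - k * hn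
    refine ⟨!![k*x*x-1, k*x*y, k*x*(z+n); k*y*x, k*y*y-1, k*y*(z+n);
      k*(z+n)*x, k*(z+n)*y, k*(z+n)*(z+n)-1], ?_, ?_⟩
    · rw [Matrix.mem_specialOrthogonalGroup_iff, Matrix.mem_orthogonalGroup_iff]
      constructor
      · ext i j
        fin_cases i <;> fin_cases j <;>
          simp [Matrix.mul_apply, Fin.sum_univ_three, Matrix.star_apply]
        · linear_combination k*x*x*hv
        · linear_combination k*x*y*hv
        · linear_combination k*x*(z+n)*hv
        · linear_combination k*x*y*hv
        · linear_combination k*y*y*hv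
        · linear_combination k*y*(z+n)*hv
        · linear_combination k*x*(z+n)*hv
        · linear_combination k*y*(z+n)*hv
        · linear_combination k*(z+n)*(z+n)*hv
      · simp [Matrix.det_fin_three]; linear_combination hv
    · ext i
      fin_cases i <;>
        simp [Matrix.toLpLin_apply, Matrix.mulVec, dotProduct, Fin.sum_univ_three, hx, hy, hz]
      · linear_combination x * hk - k * x * hn
      · linear_combination y * hk - k * y * hn
      · linear_combination (z+n) * hk - k * (z+n) * hn

lemma so_left {A : Matrix (Fin 3) (Fin 3) ℝ} (h : A ∈ Matrix.specialOrthogonalGroup (Fin 3) ℝ) :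
    star A * A = 1 :=
  (Matrix.mem_orthogonalGroup_iff' _ _).1 (Matrix.mem_specialOrthogonalGroup_iff.1 h).1

lemma so_right {A : Matrix (Fin 3) (Fin 3) ℝ} (h : A ∈ Matrix.specialOrthogonalGroup (Fin 3) ℝ) :
    A * star A = 1 :=
  (Matrix.mem_orthogonalGroup_iff _ _).1 (Matrix.mem_specialOrthogonalGroup_iff.1 h).1

lemma so_star {A : Matrix (Fin 3) (Fin 3) ℝ} (h : A ∈ Matrix.specialOrthogonalGroup (Fin 3) ℝ) :
    star A ∈ Matrix.specialOrthogonalGroup (Fin 3) ℝ := by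
  rw [Matrix.mem_specialOrthogonalGroup_iff, Matrix.mem_orthogonalGroup_iff]
  refine ⟨(congrArg (star A * ·) (star_star A)).trans (so_left h), ?_⟩
  have := (Matrix.mem_specialOrthogonalGroup_iff.1 h).2
  rw [Matrix.star_eq_conjTranspose, Matrix.det_conjTranspose, this, star_one]

lemma lin_mul (A B : Matrix (Fin 3) (Fin 3) ℝ) (v : E3) :
    Matrix.toEuclideanLin (A * B) v = Matrix.toEuclideanLin A (Matrix.toEuclideanLin B v) := by
  simp [Matrix.toLpLin_apply, Matrix.mulVec_mulVec]

lemma so_norm {A : Matrix (Fin 3) (Fin 3) ℝ} (h : A ∈ Matrix.specialOrthogonalGroup (Fin 3) ℝ)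
    (v : E3) : ‖Matrix.toEuclideanLin A v‖ = ‖v‖ := by
  have h2 := so_left h
  have : ‖Matrix.toEuclideanLin A v‖ ^ 2 = ‖v‖ ^ 2 := by
    rw [← real_inner_self_eq_norm_sq, ← real_inner_self_eq_norm_sq,
      ← LinearMap.adjoint_inner_right, ← Matrix.toEuclideanLin_conjTranspose_eq_adjoint,
      ← lin_mul, ← Matrix.star_eq_conjTranspose, h2]
    simp [Matrix.toLpLin_apply]
  exact (sq_eq_sq₀ (norm_nonneg _) (norm_nonneg _)).1 this

def pK (σ γ : ℝ) (x : E2) : Matrix (Fin 3) (Fin 3) ℝ :=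
  pRz (x 0) (√(1 - x 0 ^ 2)) * pRx σ γ * pRz (x 1) (√(1 - x 1 ^ 2))

lemma coord_lt (x : E2) (hx : x ∈ Metric.ball (0 : E2) 1) (i : Fin 2) : 0 ≤ 1 - x i ^ 2 := by
  have h1 : ‖x‖ < 1 := by simpa using hx
  have h2 : ‖x i‖ ≤ ‖x‖ := PiLp.norm_apply_le x i
  have h3 : |x i| ≤ 1 := by rw [← Real.norm_eq_abs]; linarith
  have := (sq_le_one_iff_abs_le_one (x i)).2 h3
  linarith

lemma pK_mem {σ γ : ℝ} (h : σ ^ 2 + γ ^ 2 = 1) (x : E2) (hx : x ∈ Metric.ball (0 : E2) 1) :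
    pK σ γ x ∈ Matrix.specialOrthogonalGroup (Fin 3) ℝ := by
  refine mul_mem (mul_mem (pRz_mem _ _ ?_) (pRx_mem _ _ h)) (pRz_mem _ _ ?_)
  · rw [Real.sq_sqrt (coord_lt x hx 0)]; ring
  · rw [Real.sq_sqrt (coord_lt x hx 1)]; ring

lemma pK_cont (σ γ : ℝ) : Continuous (pK σ γ) := by
  have h : ∀ i : Fin 2, Continuous fun x : E2 => pRz (x i) (√(1 - x i ^ 2)) := by
    intro i
    refine continuous_matrix fun j k => ?_
    fin_cases j <;> fin_cases k <;> simp [pRz] <;> fun_prop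
  exact ((h 0).mul continuous_const).mul (h 1)

lemma pK_norm {σ γ : ℝ} (h : σ ^ 2 + γ ^ 2 = 1) (x : E2) (hx : x ∈ Metric.ball (0 : E2) 1)
    (p q : ℝ) : ‖Matrix.toEuclideanLin (pK σ γ x) !₂[0, 0, p] - !₂[0, 0, q]‖ ^ 2 =
      p ^ 2 + q ^ 2 - 2 * p * q * γ := by
  have hs := Real.sq_sqrt (coord_lt x hx 0)
  rw [EuclideanSpace.real_norm_sq_eq, Fin.sum_univ_three]
  simp [pK, pRz, pRx, Matrix.toLpLin_apply, Matrix.mulVec, dotProduct, Fin.sum_univ_three]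
  linear_combination p ^ 2 * h + p ^ 2 * σ ^ 2 * hs

/-- Sufficiency part of item 1 of Theorem 4: a pentapod with
`M₃ = M₄ = M₅ = M` and the stated leg lengths has a 2-dimensional spherical
self-motion, obtained by placing `m₁` at `M`. -/
theorem pentapod_item1_thm4
    (m₁ m₂ m₃ m₄ m₅ M₁ M₂ M : E3) (R₂ : ℝ) (hR₂ : 0 < R₂)
    (h₁ : |‖m₂ - m₁‖ - ‖M₂ - M‖| < R₂)
    (h₂ : R₂ < ‖m₂ - m₁‖ + ‖M₂ - M‖) :
    HasTwoDimSelfMotion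
      (pentapodConfig ![m₁, m₂, m₃, m₄, m₅] ![M₁, M₂, M, M, M]
        ![‖M - M₁‖, R₂, ‖m₃ - m₁‖, ‖m₄ - m₁‖, ‖m₅ - m₁‖]) := by
  set a := m₂ - m₁ with ha
  set b := M₂ - M with hb
  have hab := abs_lt.1 h₁
  have ha0 : 0 < ‖a‖ := by linarith
  have hb0 : 0 < ‖b‖ := by linarith
  obtain ⟨A, hA, hAa⟩ := align a
  obtain ⟨B, hB, hBb⟩ := align b
  obtain ⟨γ, hγ⟩ : ∃ γ : ℝ, 2 * ‖a‖ * ‖b‖ * γ = ‖a‖ ^ 2 + ‖b‖ ^ 2 - R₂ ^ 2 :=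
    ⟨(‖a‖ ^ 2 + ‖b‖ ^ 2 - R₂ ^ 2) / (2 * ‖a‖ * ‖b‖), by field_simp⟩
  have hpos : 0 < 2 * ‖a‖ * ‖b‖ := by positivity
  have hγ1 : γ < 1 := by
    by_contra hcon
    have := mul_le_mul_of_nonneg_left (not_lt.1 hcon) hpos.le
    nlinarith
  have hγ2 : -1 < γ := by
    by_contra hcon
    have := mul_le_mul_of_nonneg_left (not_lt.1 hcon) hpos.le
    nlinarith
  have hσp : 0 < 1 - γ ^ 2 := by nlinarith
  obtain ⟨σ, hσ0, hσ⟩ : ∃ σ : ℝ, 0 < σ ∧ σ ^ 2 + γ ^ 2 = 1 :=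
    ⟨√(1 - γ ^ 2), Real.sqrt_pos.2 hσp, by rw [Real.sq_sqrt hσp.le]; ring⟩
  have hQ : Continuous fun x => star B * pK σ γ x * A :=
    (continuous_const.mul (pK_cont σ γ)).mul continuous_const
  refine ⟨fun x => (star B * pK σ γ x * A,
    M - Matrix.toEuclideanLin (star B * pK σ γ x * A) m₁), ?_, ?_, ?_⟩
  · apply Continuous.continuousOn
    refine hQ.prodMk (continuous_const.sub ?_)
    simp only [Matrix.toLpLin_apply]
    exact (PiLp.continuous_toLp 2 _).comp (hQ.matrix_mulVec continuous_const)
  · intro x hx y hy hxy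
    have h1 : star B * pK σ γ x * A = star B * pK σ γ y * A := (Prod.ext_iff.1 hxy).1
    have h2 : ∀ K : Matrix (Fin 3) (Fin 3) ℝ, B * (star B * K * A) * star A = K := by
      intro K
      calc B * (star B * K * A) * star A = (B * star B) * K * (A * star A) := by noncomm_ring
        _ = K := by rw [so_right hA, so_right hB, one_mul, mul_one]
    have h3 : pK σ γ x = pK σ γ y := by rw [← h2 (pK σ γ x), h1, h2]
    have e1 := congrFun (congrFun h3 0) 2
    have e2 := congrFun (congrFun h3 2) 0
    simp [pK, pRz, pRx, Matrix.mul_apply, Fin.sum_univ_three, hσ0.ne'] at e1 e2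
    ext i
    fin_cases i
    · exact e1
    · exact e2
  · intro x hx
    have hK := pK_mem hσ x hx
    have hmem : star B * pK σ γ x * A ∈ Matrix.specialOrthogonalGroup (Fin 3) ℝ :=
      mul_mem (mul_mem (so_star hB) hK) hA
    have hB2 : Matrix.toEuclideanLin B
        (Matrix.toEuclideanLin (star B * pK σ γ x * A) a - b) =
        Matrix.toEuclideanLin (pK σ γ x) !₂[0, 0, ‖a‖] - !₂[0, 0, ‖b‖] := by
      rw [map_sub, hBb, ← lin_mul, ← mul_assoc, ← mul_assoc, so_right hB, one_mul, lin_mul, hAa]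
    have hR : ‖Matrix.toEuclideanLin (star B * pK σ γ x * A) a - b‖ = R₂ := by
      rw [← so_norm hB, hB2]
      refine (sq_eq_sq₀ (norm_nonneg _) hR₂.le).1 ?_
      rw [pK_norm hσ x hx, hγ]; ring
    beta_reduce
    generalize star B * pK σ γ x * A = Q at *
    have hleg : ∀ m : E3, ‖Matrix.toEuclideanLin Q m + (M - Matrix.toEuclideanLin Q m₁) - M‖ =
        ‖m - m₁‖ := by
      intro m
      rw [← so_norm hmem (m - m₁), map_sub]
      congr 1; abel
    refine ⟨hmem, fun i => ?_⟩
    fin_cases i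
    · show ‖Matrix.toEuclideanLin Q m₁ + (M - Matrix.toEuclideanLin Q m₁) - M₁‖ = ‖M - M₁‖
      congr 1; abel
    · show ‖Matrix.toEuclideanLin Q m₂ + (M - Matrix.toEuclideanLin Q m₁) - M₂‖ = R₂
      rw [← hR, ha, hb, map_sub]
      congr 1; abel
    · exact hleg m₃
    · exact hleg m₄
    · exact hleg m₅


end
end

section
/- Let e, f ∈ ℝ³ be unit vectors, c ∈ (−1, 1), λ₂, λ₃, μ₂, μ₃ ∈ ℝ, and let m₁, m₄, m₅, M₁, M ∈ ℝ³. Consider the pentapod with platform points m₁, m₂ = m₁ + λ₂·e, m₃ = m₁ + λ₃·e (so m₁, m₂, m₃ are collinear), m₄, m₅, base points M₁, M₂ = M + μ₂·f, M₃ = M + μ₃·f and M₄ = M₅ = M (so M₂, M₃ and M₄ = M₅ are collinear), and leg lengths R₁ = ‖M − M₁‖, Rᵢ = √(λᵢ² + μᵢ² − 2·λᵢ·μᵢ·c) for i = 2, 3, and Rⱼ = ‖mⱼ − m₁‖ for j = 4, 5. Then its configuration set contains the image of an injective continuous map from the open unit ball of ℝ²; i.e., the pentapod has a 2-dimensional spherical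 self-motion, obtained by placing m₁ at M₄ = M₅. (Sufficiency part of item 2(b) of Theorem 4.) -/
open Metric

noncomputable section

local notation "E2" => EuclideanSpace ℝ (Fin 2)
local notation "E3" => EuclideanSpace ℝ (Fin 3)

lemma mem_SO_iff (Q : Matrix (Fin 3) (Fin 3) ℝ) :
    Q ∈ Matrix.specialOrthogonalGroup (Fin 3) ℝ ↔ Q.transpose * Q = 1 ∧ Q.det = 1 := by
  rw [Matrix.mem_specialOrthogonalGroup_iff, Matrix.mem_orthogonalGroup_iff']

/-- Rotation about the third axis. -/
def rotZ (a : ℝ) : Matrix (Fin 3) (Fin 3) ℝ :=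
  !![Real.cos a, -Real.sin a, 0; Real.sin a, Real.cos a, 0; 0, 0, 1]

/-- Rotation about the first axis. -/
def rotX (c s : ℝ) : Matrix (Fin 3) (Fin 3) ℝ :=
  !![1, 0, 0; 0, c, -s; 0, s, c]

lemma rotZ_mem (a : ℝ) : rotZ a ∈ Matrix.specialOrthogonalGroup (Fin 3) ℝ := by
  have h := Real.sin_sq_add_cos_sq a
  rw [mem_SO_iff]
  constructor
  · ext i j
    fin_cases i <;> fin_cases j <;>
      simp [rotZ, Matrix.mul_apply, Fin.sum_univ_three] <;> linarith
  · simp [rotZ, Matrix.det_fin_three]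
    linarith

lemma rotX_mem (c s : ℝ) (h : c ^ 2 + s ^ 2 = 1) :
    rotX c s ∈ Matrix.specialOrthogonalGroup (Fin 3) ℝ := by
  rw [mem_SO_iff]
  constructor
  · ext i j
    fin_cases i <;> fin_cases j <;>
      simp [rotX, Matrix.mul_apply, Fin.sum_univ_three] <;> linarith
  · simp [rotX, Matrix.det_fin_three]
    linarith

lemma exists_frame (f : Fin 3 → ℝ) (hf : f 0 ^ 2 + f 1 ^ 2 + f 2 ^ 2 = 1) :
    ∃ A ∈ Matrix.specialOrthogonalGroup (Fin 3) ℝ, ∀ i, A i 2 = f i := by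
  by_cases hr : f 2 = -1
  · have h0 : f 0 = 0 := by nlinarith [sq_nonneg (f 0), sq_nonneg (f 1)]
    have h1 : f 1 = 0 := by nlinarith [sq_nonneg (f 0), sq_nonneg (f 1)]
    refine ⟨!![1, 0, 0; 0, -1, 0; 0, 0, -1], ?_, ?_⟩
    · rw [mem_SO_iff]
      constructor
      · ext i j
        fin_cases i <;> fin_cases j <;>
          simp [Matrix.mul_apply, Fin.sum_univ_three]
      · simp [Matrix.det_fin_three]
    · intro i
      fin_cases i <;> simp [h0, h1, hr]
  · have hr' : 1 + f 2 ≠ 0 := fun h => hr (by linarith)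
    obtain ⟨k, hk⟩ : ∃ k : ℝ, k * (1 + f 2) = 1 := ⟨(1 + f 2)⁻¹, inv_mul_cancel₀ hr'⟩
    have key : k * (f 0 ^ 2 + f 1 ^ 2) = 1 - f 2 := by
      linear_combination k * hf + (1 - f 2) * hk
    refine ⟨!![1 - k * f 0 ^ 2, - (k * f 0 * f 1), f 0;
      - (k * f 0 * f 1), 1 - k * f 1 ^ 2, f 1; - f 0, - f 1, f 2], ?_, ?_⟩
    · rw [mem_SO_iff]
      constructor
      · ext i j
        fin_cases i <;> fin_cases j <;>
          simp [Matrix.mul_apply, Fin.sum_univ_three]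
        · linear_combination k * f 0 ^ 2 * key - f 0 ^ 2 * hk
        · linear_combination k * f 0 * f 1 * key - f 0 * f 1 * hk
        · linear_combination -f 0 * key
        · linear_combination k * f 0 * f 1 * key - f 0 * f 1 * hk
        · linear_combination k * f 1 ^ 2 * key - f 1 ^ 2 * hk
        · linear_combination -f 1 * key
        · linear_combination -f 0 * key
        · linear_combination -f 1 * key
        · linear_combination hf
      · simp [Matrix.det_fin_three]
        linear_combination (-f 2) * key + hf
    · intro i
      fin_cases i <;> simp

lemma inner_SO (Q : Matrix (Fin 3) (Fin 3) ℝ)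
    (hQ : Q ∈ Matrix.specialOrthogonalGroup (Fin 3) ℝ) (x y : E3) :
    inner ℝ (Matrix.toEuclideanLin Q x) (Matrix.toEuclideanLin Q y) = inner ℝ x y := by
  have h := ((mem_SO_iff Q).1 hQ).1
  rw [EuclideanSpace.inner_eq_star_dotProduct, EuclideanSpace.inner_eq_star_dotProduct]
  simp only [Matrix.toLpLin_apply, star_trivial]
  rw [Matrix.dotProduct_mulVec, Matrix.vecMul_mulVec, ← Matrix.mulVec_transpose]
  simp [Matrix.transpose_mul, h]

lemma norm_SO (Q : Matrix (Fin 3) (Fin 3) ℝ)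
    (hQ : Q ∈ Matrix.specialOrthogonalGroup (Fin 3) ℝ) (x : E3) :
    ‖Matrix.toEuclideanLin Q x‖ = ‖x‖ := by
  rw [@norm_eq_sqrt_real_inner E3, @norm_eq_sqrt_real_inner E3, inner_SO Q hQ]

lemma leg_norm (u f : E3) (hu : ‖u‖ = 1) (hf : ‖f‖ = 1) (c l m : ℝ) (h : inner ℝ u f = c) :
    ‖l • u - m • f‖ = Real.sqrt (l ^ 2 + m ^ 2 - 2 * l * m * c) := by
  rw [← Real.sqrt_sq (norm_nonneg (l • u - m • f))]
  congr 1
  rw [@norm_sub_sq_real E3, norm_smul, norm_smul, hu, hf, real_inner_smul_left,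
    real_inner_smul_right, h]
  simp
  ring

lemma mul_rot_apply (a b c s : ℝ) :
    (rotZ a * rotX c s * rotZ b) 0 2 = Real.sin a * s ∧
    (rotZ a * rotX c s * rotZ b) 2 0 = s * Real.sin b ∧
    (rotZ a * rotX c s * rotZ b) 2 2 = c := by
  simp [rotZ, rotX, Matrix.mul_apply, Fin.sum_univ_three]

lemma continuous_rotZ : Continuous rotZ := by
  refine continuous_matrix fun i j => ?_
  fin_cases i <;> fin_cases j <;> simp [rotZ] <;> fun_prop

lemma frame_apply (A : Matrix (Fin 3) (Fin 3) ℝ) (f : E3) (h : ∀ i, A i 2 = f i) :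
    Matrix.toEuclideanLin A (EuclideanSpace.single 2 1) = f := by
  ext i
  simp [Matrix.toLpLin_apply, h]

lemma exists_frame' (f : E3) (hf : ‖f‖ = 1) :
    ∃ A ∈ Matrix.specialOrthogonalGroup (Fin 3) ℝ,
      Matrix.toEuclideanLin A (EuclideanSpace.single 2 1) = f := by
  have h : f 0 ^ 2 + f 1 ^ 2 + f 2 ^ 2 = 1 := by
    have := EuclideanSpace.real_norm_sq_eq f
    rw [hf, Fin.sum_univ_three] at this
    linarith
  obtain ⟨A, hA, hAf⟩ := exists_frame f h
  exact ⟨A, hA, frame_apply A f hAf⟩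

/-- Sufficiency part of item 2(b) of Theorem 4: a pentapod with collinear
platform points `m₁, m₂, m₃`, collinear base points `M₂, M₃, M₄ = M₅ = M` and
the stated leg lengths has a 2-dimensional spherical self-motion, obtained by
placing `m₁` at `M`. -/
theorem pentapod_item2b_thm4
    (e f : E3) (he : ‖e‖ = 1) (hf : ‖f‖ = 1)
    (c : ℝ) (hc : c ∈ Set.Ioo (-1 : ℝ) 1)
    (lam₂ lam₃ mu₂ mu₃ : ℝ) (m₁ m₄ m₅ M₁ M : E3) :
    HasTwoDimSelfMotion
      (pentapodConfig ![m₁, m₁ + lam₂ • e, m₁ + lam₃ • e, m₄, m₅]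
        ![M₁, M + mu₂ • f, M + mu₃ • f, M, M]
        ![‖M - M₁‖,
          Real.sqrt (lam₂ ^ 2 + mu₂ ^ 2 - 2 * lam₂ * mu₂ * c),
          Real.sqrt (lam₃ ^ 2 + mu₃ ^ 2 - 2 * lam₃ * mu₃ * c),
          ‖m₄ - m₁‖, ‖m₅ - m₁‖]) := by
  obtain ⟨A, hA, hAf⟩ := exists_frame' f hf
  obtain ⟨B, hB, hBe⟩ := exists_frame' e he
  obtain ⟨hc1, hc2⟩ := hc
  have hpos : 0 < 1 - c ^ 2 := by nlinarith
  obtain ⟨s, hs, hcs⟩ : ∃ s : ℝ, 0 < s ∧ c ^ 2 + s ^ 2 = 1 :=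
    ⟨Real.sqrt (1 - c ^ 2), Real.sqrt_pos.2 hpos, by rw [Real.sq_sqrt hpos.le]; ring⟩
  have hA1 := ((mem_SO_iff A).1 hA).1
  have hB1 := ((mem_SO_iff B).1 hB).1
  have hBt : B.transpose ∈ Matrix.specialOrthogonalGroup (Fin 3) ℝ := by
    rw [mem_SO_iff, Matrix.transpose_transpose, Matrix.det_transpose]
    exact ⟨mul_eq_one_comm.1 hB1, ((mem_SO_iff B).1 hB).2⟩
  let R : E2 → Matrix (Fin 3) (Fin 3) ℝ := fun x => rotZ (x 0) * rotX c s * rotZ (x 1)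
  have hR : ∀ x, R x ∈ Matrix.specialOrthogonalGroup (Fin 3) ℝ := fun x =>
    mul_mem (mul_mem (rotZ_mem _) (rotX_mem c s hcs)) (rotZ_mem _)
  let Q : E2 → Matrix (Fin 3) (Fin 3) ℝ := fun x => A * R x * B.transpose
  have hQ : ∀ x, Q x ∈ Matrix.specialOrthogonalGroup (Fin 3) ℝ := fun x =>
    mul_mem (mul_mem hA (hR x)) hBt
  have hRQ : ∀ x, R x = A.transpose * Q x * B := by
    intro x
    calc R x = (A.transpose * A) * R x * (B.transpose * B) := by rw [hA1, hB1]; simp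
      _ = _ := by simp only [Q, Matrix.mul_assoc]
  have hin : ∀ x, inner ℝ (Matrix.toEuclideanLin (Q x) e) f = c := by
    intro x
    have h1 : Matrix.toEuclideanLin (Q x) e =
        Matrix.toEuclideanLin A (Matrix.toEuclideanLin (R x) (EuclideanSpace.single 2 1)) := by
      have h2 : Q x * B = A * R x := by simp only [Q, Matrix.mul_assoc, hB1, Matrix.mul_one]
      rw [← hBe]
      simp only [Matrix.toLpLin_apply, Matrix.mulVec_mulVec, h2]
    rw [h1]
    nth_rewrite 1 [← hAf]
    rw [inner_SO A hA]
    have h3 := (mul_rot_apply (x 0) (x 1) c s).2.2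
    simpa [Matrix.toLpLin_apply, EuclideanSpace.inner_single_right] using h3
  have hQc : Continuous Q := by
    have h0 : Continuous fun x : E2 => rotZ (x 0) := continuous_rotZ.comp (by fun_prop)
    have h1 : Continuous fun x : E2 => rotZ (x 1) := continuous_rotZ.comp (by fun_prop)
    exact (continuous_const.matrix_mul
      ((h0.matrix_mul continuous_const).matrix_mul h1)).matrix_mul continuous_const
  refine ⟨fun x => (Q x, M - Matrix.toEuclideanLin (Q x) m₁), ?_, ?_, ?_⟩
  · apply Continuous.continuousOn
    refine hQc.prodMk (continuous_const.sub ?_)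
    simp only [Matrix.toLpLin_apply]
    exact (PiLp.continuous_toLp 2 _).comp (hQc.matrix_mulVec continuous_const)
  · intro x hx y hy hxy
    have hQxy : Q x = Q y := congrArg Prod.fst hxy
    have hRxy : R x = R y := by rw [hRQ, hRQ, hQxy]
    have hb : ∀ z ∈ ball (0 : E2) 1, ∀ i, z i ∈ Set.Icc (-(Real.pi / 2)) (Real.pi / 2) := by
      intro z hz i
      have h1 : ‖z i‖ ≤ ‖z‖ := PiLp.norm_apply_le z i
      have h2 : ‖z‖ < 1 := by simpa using hz
      have h3 := abs_le.1 (h1.trans h2.le)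
      have h4 := Real.pi_gt_three
      exact ⟨by linarith [h3.1], by linarith [h3.2]⟩
    have hx' := mul_rot_apply (x 0) (x 1) c s
    have hy' := mul_rot_apply (y 0) (y 1) c s
    have e0 : Real.sin (x 0) * s = Real.sin (y 0) * s := by
      rw [← hx'.1, ← hy'.1]; exact congrFun (congrFun hRxy 0) 2
    have e1 : s * Real.sin (x 1) = s * Real.sin (y 1) := by
      rw [← hx'.2.1, ← hy'.2.1]; exact congrFun (congrFun hRxy 2) 0
    have f0 := Real.injOn_sin (hb x hx 0) (hb y hy 0) (mul_right_cancel₀ hs.ne' e0)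
    have f1 := Real.injOn_sin (hb x hx 1) (hb y hy 1) (mul_left_cancel₀ hs.ne' e1)
    ext i
    fin_cases i
    · exact f0
    · exact f1
  · intro x _
    refine ⟨hQ x, ?_⟩
    have hu : ‖Matrix.toEuclideanLin (Q x) e‖ = 1 := by rw [norm_SO _ (hQ x), he]
    have hleg : ∀ l m : ℝ, ‖Matrix.toEuclideanLin (Q x) (m₁ + l • e) +
        (M - Matrix.toEuclideanLin (Q x) m₁) - (M + m • f)‖ =
        Real.sqrt (l ^ 2 + m ^ 2 - 2 * l * m * c) := by
      intro l m
      rw [← leg_norm _ f hu hf c l m (hin x), map_add, map_smul]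
      congr 1
      abel
    have hsp : ∀ p : E3, ‖Matrix.toEuclideanLin (Q x) p +
        (M - Matrix.toEuclideanLin (Q x) m₁) - M‖ = ‖p - m₁‖ := by
      intro p
      rw [← norm_SO _ (hQ x) (p - m₁), map_sub]
      congr 1
      abel
    intro i
    fin_cases i
    · change ‖Matrix.toEuclideanLin (Q x) m₁ +
        (M - Matrix.toEuclideanLin (Q x) m₁) - M₁‖ = ‖M - M₁‖
      congr 1
      abel
    · exact hleg lam₂ mu₂
    · exact hleg lam₃ mu₃
    · exact hsp m₄
    · exact hsp m₅

end
end

section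
/- Let m, m₄, m₅, m₆, M₁, M₂, M₃, M₄, M ∈ ℝ³ and R₄ > 0 with |‖m₄ − m‖ − ‖M₄ − M‖| < R₄ < ‖m₄ − m‖ + ‖M₄ − M‖. Consider the hexapod with platform points m₁ = m₂ = m₃ = m, m₄, m₅, m₆, base points M₁, M₂, M₃, M₄ and M₅ = M₆ = M, and leg lengths Rᵢ = ‖M − Mᵢ‖ for i = 1, 2, 3, R₄, and Rⱼ = ‖mⱼ − m‖ for j = 5, 6. Then its configuration set contains the image of an injective continuous map from the open unit ball of ℝ²; i.e., the hexapod has a 2-dimensional spherical self-motion, obtained by placing m₁ = m₂ = m₃ at M₅ = M₆. (Sufficiency part of item 6 of Theorem 6.) -/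
open Metric

noncomputable section

local notation "E2" => EuclideanSpace ℝ (Fin 2)
local notation "E3" => EuclideanSpace ℝ (Fin 3)

/-- Configuration set of a hexapod with platform points `m`, base points `M`
and leg lengths `R`. -/
def hexapodConfig (m M : Fin 6 → EuclideanSpace ℝ (Fin 3)) (R : Fin 6 → ℝ) :
    Set Pose :=
  {p | p.1 ∈ Matrix.specialOrthogonalGroup (Fin 3) ℝ ∧
    ∀ i : Fin 6, ‖Matrix.toEuclideanLin p.1 (m i) + p.2 - M i‖ = R i}

lemma hx_frame (u : EuclideanSpace ℝ (Fin 3)) (hu : u ≠ 0) :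
    ∃ A ∈ Matrix.specialOrthogonalGroup (Fin 3) ℝ,
      Matrix.mulVec A ![0, 0, ‖u‖] = ![u 0, u 1, u 2] := by
  have hn : 0 < ‖u‖ := norm_pos_iff.mpr hu
  have hs : u 0 ^ 2 + u 1 ^ 2 + u 2 ^ 2 = ‖u‖ ^ 2 := by
    rw [EuclideanSpace.norm_sq_eq]; simp [Fin.sum_univ_three]
  obtain ⟨x, hx⟩ : ∃ x, x = u 0 / ‖u‖ := ⟨_, rfl⟩
  obtain ⟨y, hy⟩ : ∃ y, y = u 1 / ‖u‖ := ⟨_, rfl⟩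
  obtain ⟨z, hz⟩ : ∃ z, z = u 2 / ‖u‖ := ⟨_, rfl⟩
  rw [eq_div_iff hn.ne'] at hx hy hz
  have h1 : x ^ 2 + y ^ 2 + z ^ 2 = 1 := by
    have : (x ^ 2 + y ^ 2 + z ^ 2) * ‖u‖ ^ 2 = 1 * ‖u‖ ^ 2 := by
      rw [one_mul]; conv_rhs => rw [← hs, ← hx, ← hy, ← hz]
      ring
    exact mul_right_cancel₀ (by positivity) this
  rw [← hx, ← hy, ← hz]
  by_cases hz1 : 1 + z = 0
  · have hz2 : z = -1 := by linarith
    have hx0 : x = 0 := by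
      have : x ^ 2 = 0 := by rw [hz2] at h1; nlinarith [sq_nonneg x, sq_nonneg y]
      exact pow_eq_zero_iff (two_ne_zero) |>.mp this
    have hy0 : y = 0 := by
      have : y ^ 2 = 0 := by rw [hz2] at h1; nlinarith [sq_nonneg x, sq_nonneg y]
      exact pow_eq_zero_iff (two_ne_zero) |>.mp this
    subst hx0 hy0 hz2
    refine ⟨!![1, 0, 0; 0, -1, 0; 0, 0, -1], ?_, ?_⟩
    · rw [Matrix.mem_specialOrthogonalGroup_iff, Matrix.mem_orthogonalGroup_iff]
      constructor
      · ext i j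
        fin_cases i <;> fin_cases j <;> simp [Matrix.mul_apply, Fin.sum_univ_three]
      · simp [Matrix.det_fin_three]
    · ext i
      fin_cases i <;> simp [Matrix.mulVec, dotProduct, Fin.sum_univ_three]
  · obtain ⟨k, hk⟩ : ∃ k, k = 1 / (1 + z) := ⟨_, rfl⟩
    rw [eq_div_iff hz1] at hk
    have hxy : x ^ 2 * k + y ^ 2 * k = 1 - z := by
      linear_combination k * h1 + (1 - z) * hk
    refine ⟨!![1 - x ^ 2 * k, - x * y * k, x; - x * y * k, 1 - y ^ 2 * k, y; -x, -y, z], ?_, ?_⟩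
    · rw [Matrix.mem_specialOrthogonalGroup_iff, Matrix.mem_orthogonalGroup_iff]
      have hy2 : y ^ 2 = 1 - z ^ 2 - x ^ 2 := by linarith
      constructor
      · ext i j
        fin_cases i <;> fin_cases j <;>
          simp [Matrix.mul_apply, Fin.sum_univ_three]
        · linear_combination x^2 * k * hxy - x^2 * hk
        · linear_combination x*y * k * hxy - x*y * hk
        · linear_combination x * hxy
        · linear_combination x*y * k * hxy - x*y * hk
        · linear_combination y^2 * k * hxy - y^2 * hk
        · linear_combination y * hxy
        · linear_combination x * hxy
        · linear_combination y * hxy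
        · linear_combination h1
      · simp [Matrix.det_fin_three]
        linear_combination h1 - z * hxy + 0 * hk
    · ext i
      fin_cases i <;> simp [Matrix.mulVec, dotProduct, Fin.sum_univ_three]

lemma hx_norm (Q : Matrix (Fin 3) (Fin 3) ℝ) (hQ : Q ∈ Matrix.specialOrthogonalGroup (Fin 3) ℝ)
    (v : EuclideanSpace ℝ (Fin 3)) : ‖Matrix.toEuclideanLin Q v‖ = ‖v‖ := by
  have h := (Matrix.mem_orthogonalGroup_iff' _ _).mp (Matrix.mem_specialOrthogonalGroup_iff.mp hQ).1
  have : ‖Matrix.toEuclideanLin Q v‖ ^ 2 = ‖v‖ ^ 2 := by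
    rw [← real_inner_self_eq_norm_sq, ← real_inner_self_eq_norm_sq]
    simp only [Matrix.toLpLin_apply, EuclideanSpace.inner_eq_star_dotProduct, star_trivial]
    rw [Matrix.dotProduct_mulVec, Matrix.vecMul_mulVec, h, Matrix.vecMul_one]
  exact (sq_eq_sq₀ (norm_nonneg _) (norm_nonneg _)).mp this

/-- Euler-angle matrix -/
def hxE (c s : ℝ) (p q : ℝ) : Matrix (Fin 3) (Fin 3) ℝ :=
  !![Real.cos p, -Real.sin p, 0; Real.sin p, Real.cos p, 0; 0, 0, 1] *
  !![1, 0, 0; 0, c, -s; 0, s, c] *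
  !![Real.cos q, -Real.sin q, 0; Real.sin q, Real.cos q, 0; 0, 0, 1]

lemma hx_rot (p : ℝ) : !![Real.cos p, -Real.sin p, 0; Real.sin p, Real.cos p, 0; 0, 0, 1] ∈
    Matrix.specialOrthogonalGroup (Fin 3) ℝ := by
  have h := Real.sin_sq_add_cos_sq p
  rw [Matrix.mem_specialOrthogonalGroup_iff, Matrix.mem_orthogonalGroup_iff]
  constructor
  · ext i j
    fin_cases i <;> fin_cases j <;> simp [Matrix.mul_apply, Fin.sum_univ_three] <;>
      linarith
  · simp [Matrix.det_fin_three]; linarith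

lemma hxE_mem (c s p q : ℝ) (h : c ^ 2 + s ^ 2 = 1) :
    hxE c s p q ∈ Matrix.specialOrthogonalGroup (Fin 3) ℝ := by
  refine mul_mem (mul_mem (hx_rot p) ?_) (hx_rot q)
  rw [Matrix.mem_specialOrthogonalGroup_iff, Matrix.mem_orthogonalGroup_iff]
  constructor
  · ext i j
    fin_cases i <;> fin_cases j <;> simp [Matrix.mul_apply, Fin.sum_univ_three] <;>
      linarith
  · simp [Matrix.det_fin_three]; linarith

lemma hxE_cont (c s : ℝ) : Continuous fun x : EuclideanSpace ℝ (Fin 2) => hxE c s (x 0) (x 1) := by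
  unfold hxE
  refine (Continuous.matrix_mul (Continuous.matrix_mul ?_ continuous_const) ?_) <;>
  · refine continuous_matrix fun i j => ?_
    fin_cases i <;> fin_cases j <;> simp <;> fun_prop

lemma hxE_inj (c s : ℝ) (hs : s ≠ 0) (p q p' q' : ℝ) (hp : |p| < 1) (hq : |q| < 1)
    (hp' : |p'| < 1) (hq' : |q'| < 1) (h : hxE c s p q = hxE c s p' q') : p = p' ∧ q = q' := by
  have hpi := Real.pi_gt_three
  rw [abs_lt] at *
  have h02 := congrFun (congrFun h 0) 2
  have h20 := congrFun (congrFun h 2) 0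
  simp [hxE, Matrix.mul_apply, Fin.sum_univ_three, hs] at h02 h20
  constructor
  · exact Real.injOn_sin ⟨by linarith, by linarith⟩ ⟨by linarith, by linarith⟩ h02
  · exact Real.injOn_sin ⟨by linarith, by linarith⟩ ⟨by linarith, by linarith⟩ h20

lemma hxE_norm (c s p q α β : ℝ) (h : c ^ 2 + s ^ 2 = 1) :
    ‖WithLp.toLp 2 (Matrix.mulVec (hxE c s p q) ![0, 0, α] - ![0, 0, β])‖ ^ 2
      = α ^ 2 + β ^ 2 - 2 * α * β * c := by
  have hp := Real.sin_sq_add_cos_sq p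
  rw [EuclideanSpace.norm_sq_eq]
  simp [Fin.sum_univ_three, hxE]
  linear_combination (s * α) ^ 2 * hp + α ^ 2 * h

lemma hx_transpose {A : Matrix (Fin 3) (Fin 3) ℝ}
    (hA : A ∈ Matrix.specialOrthogonalGroup (Fin 3) ℝ) :
    A.transpose ∈ Matrix.specialOrthogonalGroup (Fin 3) ℝ ∧ A.transpose * A = 1 := by
  rw [Matrix.mem_specialOrthogonalGroup_iff] at hA ⊢
  have h := (Matrix.mem_orthogonalGroup_iff' _ _).mp hA.1
  refine ⟨⟨?_, ?_⟩, h⟩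
  · rw [Matrix.mem_orthogonalGroup_iff]
    simpa using h
  · rw [Matrix.det_transpose]; exact hA.2

lemma hx_vec (u : EuclideanSpace ℝ (Fin 3)) : u = WithLp.toLp 2 ![u 0, u 1, u 2] := by
  ext i
  fin_cases i <;> simp

/-- Sufficiency part of item 6 of Theorem 6: a hexapod with
`m₁ = m₂ = m₃ = m`, `M₅ = M₆ = M` and the stated leg lengths has a
2-dimensional spherical self-motion, obtained by placing `m` at `M`. -/
theorem hexapod_item6_thm6
    (m m₄ m₅ m₆ M₁ M₂ M₃ M₄ M : E3) (R₄ : ℝ) (hR₄ : 0 < R₄)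
    (h₁ : |‖m₄ - m‖ - ‖M₄ - M‖| < R₄)
    (h₂ : R₄ < ‖m₄ - m‖ + ‖M₄ - M‖) :
    HasTwoDimSelfMotion
      (hexapodConfig ![m, m, m, m₄, m₅, m₆] ![M₁, M₂, M₃, M₄, M, M]
        ![‖M - M₁‖, ‖M - M₂‖, ‖M - M₃‖, R₄, ‖m₅ - m‖, ‖m₆ - m‖]) := by
  have hRle := abs_lt.mp h₁
  have hα : 0 < ‖m₄ - m‖ := by
    linarith [norm_nonneg (M₄ - M), norm_nonneg (m₄ - m)]
  have hβ : 0 < ‖M₄ - M‖ := by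
    linarith [norm_nonneg (M₄ - M), norm_nonneg (m₄ - m)]
  obtain ⟨A, hA, hAa⟩ := hx_frame (m₄ - m) (norm_pos_iff.mp hα)
  obtain ⟨B, hB, hBb⟩ := hx_frame (M₄ - M) (norm_pos_iff.mp hβ)
  have ha := hx_vec (m₄ - m)
  have hb := hx_vec (M₄ - M)
  rw [← hAa] at ha
  rw [← hBb] at hb
  obtain ⟨hAt, hAt1⟩ := hx_transpose hA
  obtain ⟨hBt, hBt1⟩ := hx_transpose hB
  obtain ⟨α, hαe⟩ : ∃ α, α = ‖m₄ - m‖ := ⟨_, rfl⟩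
  obtain ⟨β, hβe⟩ : ∃ β, β = ‖M₄ - M‖ := ⟨_, rfl⟩
  rw [← hαe] at ha hα hRle h₂
  rw [← hβe] at hb hβ hRle h₂
  obtain ⟨c, hc⟩ : ∃ c, c = (α ^ 2 + β ^ 2 - R₄ ^ 2) / (2 * α * β) := ⟨_, rfl⟩
  have hab : 0 < 2 * α * β := by positivity
  have hc' : 2 * α * β * c = α ^ 2 + β ^ 2 - R₄ ^ 2 := by
    rw [hc]; field_simp
  have hc1 : c < 1 := by
    rw [hc, div_lt_one hab]
    nlinarith
  have hc2 : -1 < c := by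
    rw [hc, lt_div_iff₀ hab]
    nlinarith
  have hpos : 0 < 1 - c ^ 2 := by nlinarith
  obtain ⟨s, hs⟩ : ∃ s, s = Real.sqrt (1 - c ^ 2) := ⟨_, rfl⟩
  have hs0 : s ≠ 0 := by rw [hs]; exact (Real.sqrt_pos.mpr hpos).ne'
  have hcs : c ^ 2 + s ^ 2 = 1 := by rw [hs, Real.sq_sqrt hpos.le]; ring
  let Q : E2 → Matrix (Fin 3) (Fin 3) ℝ := fun x => B * hxE c s (x 0) (x 1) * A.transpose
  have hQ : ∀ x, Q x ∈ Matrix.specialOrthogonalGroup (Fin 3) ℝ := fun x =>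
    mul_mem (mul_mem hB (hxE_mem c s _ _ hcs)) hAt
  have hQc : Continuous Q :=
    (continuous_const.matrix_mul (hxE_cont c s)).matrix_mul continuous_const
  refine ⟨fun x => (Q x, M - Matrix.toEuclideanLin (Q x) m), ?_, ?_, ?_⟩
  · apply Continuous.continuousOn
    refine hQc.prodMk (continuous_const.sub ?_)
    simp only [Matrix.toLpLin_apply]
    exact (PiLp.continuous_toLp 2 _).comp (hQc.matrix_mulVec continuous_const)
  · intro x hx y hy hxy
    have hq : Q x = Q y := congrArg Prod.fst hxy
    have he : ∀ z, B.transpose * Q z * A = hxE c s (z 0) (z 1) := by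
      intro z
      simp only [Q]
      calc B.transpose * (B * hxE c s (z 0) (z 1) * A.transpose) * A
          = (B.transpose * B) * hxE c s (z 0) (z 1) * (A.transpose * A) := by noncomm_ring
        _ = _ := by rw [hAt1, hBt1]; simp
    have hb' : ∀ z ∈ Metric.ball (0 : E2) 1, ∀ i, |z i| < 1 := by
      intro z hz i
      rw [mem_ball_zero_iff] at hz
      exact lt_of_le_of_lt (by simpa using PiLp.norm_apply_le z i) hz
    have := hxE_inj c s hs0 _ _ _ _ (hb' x hx 0) (hb' x hx 1) (hb' y hy 0) (hb' y hy 1)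
      (by rw [← he x, ← he y, hq])
    ext i
    fin_cases i
    · exact this.1
    · exact this.2
  · intro x hx
    refine ⟨hQ x, ?_⟩
    have key : ∀ u V : E3, Matrix.toEuclideanLin (Q x) u + (M - Matrix.toEuclideanLin (Q x) m) - V
        = Matrix.toEuclideanLin (Q x) (u - m) - (V - M) := by
      intro u V
      rw [map_sub]; abel
    have h4 : ‖Matrix.toEuclideanLin (Q x) (m₄ - m) - (M₄ - M)‖ = R₄ := by
      have e : Matrix.toEuclideanLin (Q x) (m₄ - m) - (M₄ - M) =
          Matrix.toEuclideanLin B (WithLp.toLp 2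
            (Matrix.mulVec (hxE c s (x 0) (x 1)) ![0, 0, α] - ![0, 0, β])) := by
        rw [ha, hb]
        simp only [Matrix.toLpLin_apply, Matrix.mulVec_sub, Matrix.mulVec_mulVec, WithLp.toLp_sub, WithLp.ofLp_sub,
          Q, Matrix.mul_assoc, hAt1, Matrix.mul_one]
      rw [e, hx_norm B hB, ← sq_eq_sq₀ (norm_nonneg _) hR₄.le, hxE_norm _ _ _ _ _ _ hcs, hc']
      ring
    intro i
    simp only [key]
    fin_cases i
    · simp [norm_sub_rev]
    · simp [norm_sub_rev]
    · simp [norm_sub_rev]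
    · exact h4
    · simpa using hx_norm (Q x) (hQ x) (m₅ - m)
    · simpa using hx_norm (Q x) (hQ x) (m₆ - m)

end
end
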